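/- arXiv:1304.3813 — 2 statements merged into one kernel-verified Lean document; each statement's English description precedes it below -/
import Mathlib

section
/- Let n be a natural number, let f : ℝⁿ → ℝ be a continuously differentiable function, and let u, v : ℝⁿ → ℝ be twice continuously differentiable compactly supported functions. Then the Witten Laplacian is symmetric as a bilinear form on compactly supported functions with respect to the weighted measure e^{−f}dx: ∫_{ℝⁿ} ( −Δu(x) + ⟨∇f(x), ∇u(x)⟩ ) · v(x) · e^{−f(x)} dx = ∫_{ℝⁿ} u(x) · ( −Δv(x) + ⟨∇f(x), ∇v(x)⟩ ) · e^{−f(x)} dx, where both integrals are with respect to Lebesgue measure on ℝⁿ. -/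
open MeasureTheory
open scoped InnerProductSpace

/-- The Euclidean Laplacian: the sum of pure second partial derivatives. -/
noncomputable def lap {n : ℕ} (u : EuclideanSpace ℝ (Fin n) → ℝ)
    (x : EuclideanSpace ℝ (Fin n)) : ℝ :=
  ∑ i : Fin n,
    iteratedFDeriv ℝ 2 u x ![EuclideanSpace.single i 1, EuclideanSpace.single i 1]

/-- The inner product of two gradients is the sum of the products of partial derivatives. -/
theorem inner_gradient_gradient_eq_sum {n : ℕ} (f u : EuclideanSpace ℝ (Fin n) → ℝ)
    (x : EuclideanSpace ℝ (Fin n)) :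
    ⟪gradient f x, gradient u x⟫_ℝ =
      ∑ i, fderiv ℝ f x (EuclideanSpace.single i 1) * fderiv ℝ u x (EuclideanSpace.single i 1) := by
  rw [← (EuclideanSpace.basisFun (Fin n) ℝ).sum_inner_mul_inner]
  refine Finset.sum_congr rfl fun i _ => ?_
  rw [real_inner_comm (gradient u x), inner_gradient_left, inner_gradient_left,
    EuclideanSpace.basisFun_apply]

theorem ContDiff.continuous_fderiv_fderiv_apply {E : Type*} [NormedAddCommGroup E]
    [NormedSpace ℝ E] {u : E → ℝ} (hu : ContDiff ℝ 2 u) (e : E) :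
    Continuous fun x => fderiv ℝ (fun y => fderiv ℝ u y e) x e :=
  ((hu.fderiv_right (m := 1) (by norm_num)).clm_apply contDiff_const).continuous_fderiv_apply
    one_ne_zero |>.comp (by fun_prop : Continuous fun x : E => (x, e))

/-- Integration by parts in one direction for the weight `exp (-f)`. -/
theorem integral_weighted_second_deriv_eq {E : Type*} [NormedAddCommGroup E] [NormedSpace ℝ E]
    [FiniteDimensional ℝ E] [MeasurableSpace E] [BorelSpace E] {μ : Measure E}
    [μ.IsAddHaarMeasure] {f u v : E → ℝ}
    (hf : ContDiff ℝ 1 f) (hu : ContDiff ℝ 2 u) (hv : ContDiff ℝ 1 v)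
    (hvc : HasCompactSupport v) (e : E) :
    ∫ x, (-fderiv ℝ (fun y => fderiv ℝ u y e) x e + fderiv ℝ f x e * fderiv ℝ u x e) * v x *
        Real.exp (-f x) ∂μ =
      ∫ x, fderiv ℝ u x e * fderiv ℝ v x e * Real.exp (-f x) ∂μ := by
  have hdu : ContDiff ℝ 1 fun y => fderiv ℝ u y e :=
    (hu.fderiv_right (by norm_num)).clm_apply contDiff_const
  have hduc := hdu.continuous
  have hddu := hu.continuous_fderiv_fderiv_apply e
  have hdf : Continuous fun x => fderiv ℝ f x e :=
    (hf.continuous_fderiv one_ne_zero).clm_apply continuous_const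
  have hdv : Continuous fun x => fderiv ℝ v x e :=
    (hv.continuous_fderiv one_ne_zero).clm_apply continuous_const
  have hfc := hf.continuous
  have hvcont := hv.continuous
  have hdvc : HasCompactSupport fun x => fderiv ℝ v x e := hvc.fderiv_apply ℝ e
  have hfd := hf.differentiable one_ne_zero
  have hvd := hv.differentiable one_ne_zero
  have hg : Differentiable ℝ fun x => v x * Real.exp (-f x) := by fun_prop
  have hg' (x : E) : fderiv ℝ (fun x => v x * Real.exp (-f x)) x e =
      fderiv ℝ v x e * Real.exp (-f x) - fderiv ℝ f x e * v x * Real.exp (-f x) := by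
    have hprod : HasFDerivAt (fun x => v x * Real.exp (-f x)) _ x :=
      (hvd x).hasFDerivAt.mul (hfd x).hasFDerivAt.neg.exp
    rw [hprod.fderiv]
    simp
    ring
  have hint₁ : Integrable (fun x => fderiv ℝ u x e * fderiv ℝ v x e * Real.exp (-f x)) μ :=
    Continuous.integrable_of_hasCompactSupport (by fun_prop) (hdvc.mul_left.mul_right)
  have hint₂ : Integrable
      (fun x => fderiv ℝ f x e * fderiv ℝ u x e * v x * Real.exp (-f x)) μ :=
    Continuous.integrable_of_hasCompactSupport (by fun_prop) (hvc.mul_left.mul_right)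
  have hint₃ : Integrable
      (fun x => v x * Real.exp (-f x) * fderiv ℝ (fun y => fderiv ℝ u y e) x e) μ :=
    Continuous.integrable_of_hasCompactSupport (by fun_prop) (hvc.mul_right.mul_right)
  have hint₄ : Integrable (fun x => v x * Real.exp (-f x) * fderiv ℝ u x e) μ :=
    Continuous.integrable_of_hasCompactSupport (by fun_prop) (hvc.mul_right.mul_right)
  have hprod (x : E) : fderiv ℝ (fun x => v x * Real.exp (-f x)) x e * fderiv ℝ u x e =
      fderiv ℝ u x e * fderiv ℝ v x e * Real.exp (-f x) -
        fderiv ℝ f x e * fderiv ℝ u x e * v x * Real.exp (-f x) := by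
    rw [hg']; ring
  have key := integral_mul_fderiv_eq_neg_fderiv_mul_of_integrable (μ := μ) (v := e)
    (f := fun x => v x * Real.exp (-f x)) (g := fun y => fderiv ℝ u y e)
    (by simp only [hprod]; exact hint₁.sub hint₂) hint₃ hint₄
    (fun x _ => hg x) (fun x _ => hdu.differentiable one_ne_zero x)
  simp only [hprod] at key
  rw [integral_sub hint₁ hint₂] at key
  calc
    _ = ∫ x, fderiv ℝ f x e * fderiv ℝ u x e * v x * Real.exp (-f x) -
          v x * Real.exp (-f x) * fderiv ℝ (fun y => fderiv ℝ u y e) x e ∂μ := by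
      congr 1 with x
      ring
    _ = _ := by
      rw [integral_sub hint₂ hint₃, key]
      ring

/-- The quadratic form of the Witten Laplacian is the weighted Dirichlet form. -/
theorem integral_witten_mul_eq_dirichlet {n : ℕ} {f u v : EuclideanSpace ℝ (Fin n) → ℝ}
    (hf : ContDiff ℝ 1 f) (hu : ContDiff ℝ 2 u) (hv : ContDiff ℝ 1 v)
    (hvc : HasCompactSupport v) :
    ∫ x, (-lap u x + ⟪gradient f x, gradient u x⟫_ℝ) * v x * Real.exp (-f x) =
      ∑ i : Fin n, ∫ x, fderiv ℝ u x (EuclideanSpace.single i 1) *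
        fderiv ℝ v x (EuclideanSpace.single i 1) * Real.exp (-f x) := by
  have hfc := hf.continuous
  have hvcont := hv.continuous
  have hsecond (x e : EuclideanSpace ℝ (Fin n)) :
      iteratedFDeriv ℝ 2 u x ![e, e] = fderiv ℝ (fun y => fderiv ℝ u y e) x e := by
    have hd : DifferentiableAt ℝ (fderiv ℝ u) x :=
      (hu.fderiv_right (m := 1) (by norm_num)).differentiable one_ne_zero x
    rw [iteratedFDeriv_two_apply, fderiv_clm_apply hd (differentiableAt_const e)]
    simp
  calc
    _ = ∫ x, ∑ i : Fin n,
          (-fderiv ℝ (fun y => fderiv ℝ u y (EuclideanSpace.single i 1)) x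
            (EuclideanSpace.single i 1) +
          fderiv ℝ f x (EuclideanSpace.single i 1) * fderiv ℝ u x (EuclideanSpace.single i 1)) *
          v x * Real.exp (-f x) := by
      congr 1 with x
      simp only [lap, hsecond, inner_gradient_gradient_eq_sum, ← Finset.sum_neg_distrib,
        ← Finset.sum_add_distrib, Finset.sum_mul]
    _ = _ := by
      rw [integral_finsetSum]
      · exact Finset.sum_congr rfl fun i _ => integral_weighted_second_deriv_eq hf hu hv hvc _
      · intro i _
        have hddu := hu.continuous_fderiv_fderiv_apply (EuclideanSpace.single i (1 : ℝ))
        have hdf : Continuous fun x => fderiv ℝ f x (EuclideanSpace.single i (1 : ℝ)) :=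
          (hf.continuous_fderiv one_ne_zero).clm_apply continuous_const
        have hdu : Continuous fun x => fderiv ℝ u x (EuclideanSpace.single i (1 : ℝ)) :=
          (hu.continuous_fderiv two_ne_zero).clm_apply continuous_const
        exact Continuous.integrable_of_hasCompactSupport (by fun_prop) (hvc.mul_left.mul_right)

theorem witten_symmetric (n : ℕ) (f u v : EuclideanSpace ℝ (Fin n) → ℝ)
    (hf : ContDiff ℝ 1 f) (hu : ContDiff ℝ 2 u) (hv : ContDiff ℝ 2 v)
    (huc : HasCompactSupport u) (hvc : HasCompactSupport v) :
    ∫ x, (-lap u x + ⟪gradient f x, gradient u x⟫_ℝ) * v x * Real.exp (-f x) =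
    ∫ x, u x * (-lap v x + ⟪gradient f x, gradient v x⟫_ℝ) * Real.exp (-f x) := by
  have hswap :
      ∫ x, u x * (-lap v x + ⟪gradient f x, gradient v x⟫_ℝ) * Real.exp (-f x) =
        ∫ x, (-lap v x + ⟪gradient f x, gradient v x⟫_ℝ) * u x * Real.exp (-f x) := by
    congr 1 with x
    ring
  rw [hswap, integral_witten_mul_eq_dirichlet hf hu (hv.of_le (by norm_num)) hvc,
    integral_witten_mul_eq_dirichlet hf hv (hu.of_le (by norm_num)) huc]
  refine Finset.sum_congr rfl fun i _ => ?_
  congr 1 with x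
  ring
end

section
/- Let n be a natural number, let f : ℝⁿ → ℝ be a twice continuously differentiable function, and let v : ℝⁿ → ℝ be a twice continuously differentiable compactly supported function. Then the Dirichlet form of the Witten Laplacian of the function u := e^{f/2}·v with respect to the weighted measure e^{−f}dx equals the Schrödinger quadratic form of v with respect to Lebesgue measure: ∫_{ℝⁿ} ‖∇(e^{f/2}v)(x)‖² · e^{−f(x)} dx = ∫_{ℝⁿ} ( ‖∇v(x)‖² + ( (1/4)·‖∇f(x)‖² − (1/2)·Δf(x) ) · (v(x))² ) dx, where both integrals are with respect to Lebesgue measure on ℝⁿ. -/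
open MeasureTheory
open scoped InnerProductSpace

/-- The integral of a directional derivative of a compactly supported `C¹` function vanishes. -/
theorem integral_fderiv_apply_eq_zero {E : Type*} [NormedAddCommGroup E] [NormedSpace ℝ E]
    [FiniteDimensional ℝ E] [MeasurableSpace E] [BorelSpace E] (μ : Measure E)
    [μ.IsAddHaarMeasure] {g : E → ℝ} (hg : ContDiff ℝ 1 g) (hgc : HasCompactSupport g) (e : E) :
    ∫ x, fderiv ℝ g x e ∂μ = 0 := by
  have hint : Integrable (fun x => fderiv ℝ g x e) μ :=
    ((hg.continuous_fderiv one_ne_zero).clm_apply continuous_const).integrable_of_hasCompactSupport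
      (hgc.fderiv_apply ℝ e)
  have h := integral_mul_fderiv_eq_neg_fderiv_mul_of_integrable (μ := μ) (f := fun _ => (1 : ℝ))
    (g := g) (v := e) (by simp) (by simpa using hint)
    (by simpa using hg.continuous.integrable_of_hasCompactSupport hgc)
    (fun x _ => by fun_prop) (fun x _ => hg.differentiable one_ne_zero x)
  simpa using h

/-- The squared norm of the gradient is the sum of the squares of the partial derivatives. -/
theorem norm_gradient_sq_eq_sum {n : ℕ} (u : EuclideanSpace ℝ (Fin n) → ℝ)
    (x : EuclideanSpace ℝ (Fin n)) :
    ‖gradient u x‖ ^ 2 = ∑ i, (fderiv ℝ u x (EuclideanSpace.single i 1)) ^ 2 := by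
  rw [EuclideanSpace.real_norm_sq_eq]
  refine Finset.sum_congr rfl fun i _ => ?_
  rw [← inner_gradient_left, EuclideanSpace.inner_single_right]
  simp

theorem lap_eq_sum_fderiv_fderiv {n : ℕ} {u : EuclideanSpace ℝ (Fin n) → ℝ}
    (hu : ContDiff ℝ 2 u) (x : EuclideanSpace ℝ (Fin n)) :
    lap u x = ∑ i, fderiv ℝ (fun y => fderiv ℝ u y (EuclideanSpace.single i 1)) x
      (EuclideanSpace.single i 1) := by
  refine Finset.sum_congr rfl fun i _ => ?_
  have hd : DifferentiableAt ℝ (fderiv ℝ u) x :=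
    (hu.fderiv_right (m := 1) (by norm_num)).differentiable one_ne_zero x
  rw [iteratedFDeriv_two_apply, fderiv_clm_apply hd (differentiableAt_const _)]
  simp

theorem ContDiff.continuous_lap {n : ℕ} {u : EuclideanSpace ℝ (Fin n) → ℝ}
    (hu : ContDiff ℝ 2 u) : Continuous (lap u) := by
  refine continuous_finsetSum _ fun i _ => ?_
  have h := hu.continuous_iteratedFDeriv (m := 2) le_rfl
  fun_prop

theorem ContDiff.continuous_norm_gradient_sq {n : ℕ} {u : EuclideanSpace ℝ (Fin n) → ℝ}
    (hu : ContDiff ℝ 1 u) : Continuous fun x => ‖gradient u x‖ ^ 2 := by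
  simp_rw [norm_gradient_sq_eq_sum]
  have := hu.continuous_fderiv one_ne_zero
  fun_prop

/-- The Dirichlet and Schrödinger integrands differ by the divergence of `(1 / 2) v² ∇f`. -/
theorem norm_gradient_exp_mul_sq_mul_exp_neg {n : ℕ} {f v : EuclideanSpace ℝ (Fin n) → ℝ}
    (hf : ContDiff ℝ 2 f) (hv : Differentiable ℝ v) (x : EuclideanSpace ℝ (Fin n)) :
    ‖gradient (fun y => Real.exp (f y / 2) * v y) x‖ ^ 2 * Real.exp (-f x) =
      (‖gradient v x‖ ^ 2 + ((1 / 4) * ‖gradient f x‖ ^ 2 - (1 / 2) * lap f x) * (v x) ^ 2) +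
      (1 / 2) * ∑ i, fderiv ℝ (fun y => v y ^ 2 * fderiv ℝ f y (EuclideanSpace.single i 1)) x
        (EuclideanSpace.single i 1) := by
  have hfx : HasFDerivAt f (fderiv ℝ f x) x := (hf.differentiable two_ne_zero x).hasFDerivAt
  have hvx : HasFDerivAt v (fderiv ℝ v x) x := (hv x).hasFDerivAt
  have hexp : Real.exp (f x / 2) ^ 2 * Real.exp (-f x) = 1 := by
    rw [← Real.exp_nat_mul, ← Real.exp_add]
    simp [mul_div_cancel₀]
  simp only [norm_gradient_sq_eq_sum, lap_eq_sum_fderiv_fderiv hf, Finset.mul_sum, Finset.sum_mul,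
    ← Finset.sum_sub_distrib, ← Finset.sum_add_distrib]
  refine Finset.sum_congr rfl fun i _ => ?_
  set e : EuclideanSpace ℝ (Fin n) := EuclideanSpace.single i 1
  have hu : fderiv ℝ (fun y => Real.exp (f y / 2) * v y) x e =
      Real.exp (f x / 2) * (fderiv ℝ v x e + (1 / 2) * v x * fderiv ℝ f x e) := by
    have h := ((hfx.mul_const (1 / 2 : ℝ)).exp.fun_mul hvx).fderiv
    simp only [mul_one_div] at h
    rw [h]
    simp
    ring
  have hdf : DifferentiableAt ℝ (fun y => fderiv ℝ f y e) x :=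
    ((hf.fderiv_right (m := 1) (by norm_num)).clm_apply contDiff_const).differentiable
      one_ne_zero x
  have hw : fderiv ℝ (fun y => v y ^ 2 * fderiv ℝ f y e) x e =
      v x ^ 2 * fderiv ℝ (fun y => fderiv ℝ f y e) x e +
        2 * v x * fderiv ℝ v x e * fderiv ℝ f x e := by
    rw [((hvx.pow 2).fun_mul hdf.hasFDerivAt).fderiv]
    simp
    ring
  rw [hu, hw]
  linear_combination (fderiv ℝ v x e + (1 / 2) * v x * fderiv ℝ f x e) ^ 2 * hexp

theorem dirichlet_form_eq_schrodinger_form (n : ℕ) (f v : EuclideanSpace ℝ (Fin n) → ℝ)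
    (hf : ContDiff ℝ 2 f) (hv : ContDiff ℝ 2 v) (hvc : HasCompactSupport v) :
    ∫ x, ‖gradient (fun y => Real.exp (f y / 2) * v y) x‖ ^ 2 * Real.exp (-f x) =
    ∫ x, (‖gradient v x‖ ^ 2 +
      ((1 / 4) * ‖gradient f x‖ ^ 2 - (1 / 2) * lap f x) * (v x) ^ 2) := by
  have hv1 : ContDiff ℝ 1 v := hv.of_le one_le_two
  have hw (i : Fin n) : ContDiff ℝ 1
      (fun y => v y ^ 2 * fderiv ℝ f y (EuclideanSpace.single i 1)) :=
    (hv1.pow 2).mul ((hf.fderiv_right (by norm_num)).clm_apply contDiff_const)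
  have hwc (i : Fin n) : HasCompactSupport
      (fun y => v y ^ 2 * fderiv ℝ f y (EuclideanSpace.single i 1)) :=
    hvc.mono fun y hy hvy => hy (by simp [hvy])
  have hwint (i : Fin n) : Integrable (fun x => fderiv ℝ
      (fun y => v y ^ 2 * fderiv ℝ f y (EuclideanSpace.single i 1)) x
        (EuclideanSpace.single i 1)) :=
    (((hw i).continuous_fderiv one_ne_zero).clm_apply
      continuous_const).integrable_of_hasCompactSupport ((hwc i).fderiv_apply ℝ _)
  have hRint : Integrable (fun x => ‖gradient v x‖ ^ 2 +
      ((1 / 4) * ‖gradient f x‖ ^ 2 - (1 / 2) * lap f x) * (v x) ^ 2) := by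
    refine Continuous.integrable_of_hasCompactSupport ?_ ?_
    · have h₁ := hv1.continuous_norm_gradient_sq
      have h₂ := (hf.of_le one_le_two).continuous_norm_gradient_sq
      have h₃ := hf.continuous_lap
      have h₄ := hv.continuous
      fun_prop
    · refine HasCompactSupport.intro hvc fun x hx => ?_
      simp [gradient, fderiv_of_notMem_tsupport ℝ hx, image_eq_zero_of_notMem_tsupport hx]
  simp_rw [norm_gradient_exp_mul_sq_mul_exp_neg hf (hv.differentiable two_ne_zero)]
  rw [integral_add hRint ((integrable_finsetSum _ fun i _ => hwint i).const_mul _),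
    integral_const_mul, integral_finsetSum _ fun i _ => hwint i]
  simp [integral_fderiv_apply_eq_zero volume (hw _) (hwc _)]
end
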